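/- Let R > 0, let Ω ⊆ ℝ² be an open set with Lebesgue measure πR², and let ρ : ℝ² → ℝ be a measurable function with |ρ(x)| ≤ 1 for all x. Then for every infinitely differentiable function v : ℝ² → ℝ with compact support contained in Ω, one has (1/2)∫_{ℝ²}(Δv)² dx − ∫_{ℝ²} ρ v dx ≥ − π R⁶ / 384. -/

import Mathlib

open MeasureTheory Real

/-- The Laplacian of `f : ℝ^N → ℝ`: the sum of the second partial derivatives
`∑ i, ∂²f/∂xᵢ²` (the trace of the Hessian). -/
noncomputable def laplacian {N : ℕ} (f : EuclideanSpace ℝ (Fin N) → ℝ)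
    (x : EuclideanSpace ℝ (Fin N)) : ℝ :=
  ∑ i : Fin N, fderiv ℝ (fun y => fderiv ℝ f y (EuclideanSpace.single i 1)) x
    (EuclideanSpace.single i 1)

/-- Smoothed half absolute value, with its derivative and its second derivative. -/
lemma exists_kernel (ε : ℝ) (hε : 0 < ε) : ∃ A Θ κ : ℝ → ℝ,
    (∀ a, HasDerivAt A (Θ a) a) ∧ (∀ a, HasDerivAt Θ (κ a) a) ∧ Continuous κ ∧
    A 0 = 0 ∧ (∀ a, A (-a) = A a) ∧ (∀ a, Θ (-a) = -Θ a) ∧ (∀ a, κ (-a) = κ a) ∧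
    (∀ a, 0 ≤ κ a) ∧ (∃ C, ∀ a, κ a ≤ C) ∧ (∀ a, |Θ a| ≤ 1/2) ∧ (∀ a, |a| - ε ≤ 2 * A a) := by
  have hpos : ∀ a : ℝ, 0 < a^2 + ε^2 := fun a => by positivity
  have hs : ∀ a : ℝ, 0 < √(a^2 + ε^2) := fun a => Real.sqrt_pos.2 (hpos a)
  have hsq : ∀ a : ℝ, √(a^2 + ε^2) ^ 2 = a^2 + ε^2 := fun a => Real.sq_sqrt (hpos a).le
  have hd : ∀ a : ℝ, HasDerivAt (fun a : ℝ => √(a^2 + ε^2)) (a / √(a^2 + ε^2)) a := by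
    intro a
    have h1 : HasDerivAt (fun a : ℝ => a^2 + ε^2) (2 * a) a := by
      simpa using (hasDerivAt_pow 2 a).add_const (ε^2)
    convert h1.sqrt (hpos a).ne' using 1
    field_simp
  have hge : ∀ a : ℝ, |a| ≤ √(a^2 + ε^2) := fun a => by
    rw [← Real.sqrt_sq_eq_abs]; exact Real.sqrt_le_sqrt (by nlinarith [sq_nonneg ε])
  have hge2 : ∀ a : ℝ, ε ≤ √(a^2 + ε^2) := fun a => by
    apply Real.le_sqrt_of_sq_le; nlinarith [sq_nonneg a]
  refine ⟨fun a => (√(a^2 + ε^2) - ε) / 2, fun a => a / √(a^2 + ε^2) / 2,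
    fun a => ε^2 / (√(a^2 + ε^2))^3 / 2, ?_, ?_, ?_, ?_, ?_, ?_, ?_, ?_, ?_, ?_, ?_⟩
  · intro a; exact ((hd a).sub_const ε).div_const 2
  · intro a
    have := ((hasDerivAt_id a).div (hd a) (hs a).ne').div_const 2
    refine this.congr_deriv ?_
    have h2 := (hs a).ne'
    have h3 : √(a^2 + ε^2) - a * (a / √(a^2 + ε^2)) = ε^2 / √(a^2 + ε^2) := by
      field_simp
      rw [hsq a]; ring
    simp only [id, one_mul]
    rw [h3]
    field_simp
  · have : Continuous fun a : ℝ => √(a^2 + ε^2) := by fun_prop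
    exact (continuous_const.div (this.pow 3) (fun a => (pow_pos (hs a) 3).ne')).div_const 2
  · simp [Real.sqrt_sq hε.le]
  · intro a; simp
  · intro a; simp; ring
  · intro a; simp
  · intro a; have := hs a; positivity
  · refine ⟨ε^2 / ε^3 / 2, fun a => ?_⟩
    have := hge2 a
    show ε^2 / (√(a^2 + ε^2))^3 / 2 ≤ ε^2 / ε^3 / 2
    gcongr
  · intro a
    have h1 := hs a
    rw [abs_div, abs_div, abs_of_pos h1, abs_two]
    have : |a| / √(a^2 + ε^2) ≤ 1 := (div_le_one h1).2 (hge a)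
    linarith
  · intro a; have := hge a; simp only; linarith

abbrev E2 := EuclideanSpace ℝ (Fin 2)

noncomputable def ev (θ : ℝ) : E2 := !₂[cos θ, sin θ]
noncomputable def tv (θ : ℝ) : E2 := !₂[-sin θ, cos θ]
noncomputable def Jr (z : E2) : E2 := !₂[-z 1, z 0]

lemma hasDerivAt_ev (θ : ℝ) : HasDerivAt ev (tv θ) θ := by
  have : HasDerivAt (fun θ => ![cos θ, sin θ]) ![-sin θ, cos θ] θ := by
    rw [hasDerivAt_pi]; intro i; fin_cases i
    · simpa using Real.hasDerivAt_cos θ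
    · simpa using Real.hasDerivAt_sin θ
  exact ((PiLp.continuousLinearEquiv 2 ℝ (fun _ : Fin 2 => ℝ)).symm.hasFDerivAt).comp_hasDerivAt θ this

lemma hasDerivAt_tv (θ : ℝ) : HasDerivAt tv (-ev θ) θ := by
  have : HasDerivAt (fun θ => ![-sin θ, cos θ]) (-![cos θ, sin θ]) θ := by
    rw [hasDerivAt_pi]; intro i; fin_cases i
    · simpa using! (Real.hasDerivAt_sin θ).neg
    · simpa using Real.hasDerivAt_cos θ
  exact ((PiLp.continuousLinearEquiv 2 ℝ (fun _ : Fin 2 => ℝ)).symm.hasFDerivAt).comp_hasDerivAt θ this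

lemma continuous_ev : Continuous ev :=
  continuous_iff_continuousAt.2 fun θ => (hasDerivAt_ev θ).continuousAt

lemma continuous_tv : Continuous tv :=
  continuous_iff_continuousAt.2 fun θ => (hasDerivAt_tv θ).continuousAt

lemma norm_ev (θ : ℝ) : ‖ev θ‖ = 1 := by
  rw [EuclideanSpace.norm_eq]; simp [ev]

lemma Jr_smul (r θ : ℝ) : Jr (r • ev θ) = r • tv θ := by
  ext i; fin_cases i <;> simp [Jr, ev, tv]

lemma integral_polar (f : E2 → ℝ) :
    ∫ z, f z = ∫ p in Set.Ioi (0:ℝ) ×ˢ Set.Ioo (-π) π, p.1 * f (p.1 • ev p.2) := by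
  have h1 : ∫ z, f z = ∫ p : ℝ × ℝ, f (!₂[p.1, p.2]) := by
    rw [← (PiLp.volume_preserving_toLp (Fin 2)).integral_comp
      (MeasurableEquiv.toLp 2 (Fin 2 → ℝ)).measurableEmbedding,
      ← (volume_preserving_finTwoArrow ℝ).symm.integral_comp
        (MeasurableEquiv.finTwoArrow).symm.measurableEmbedding]
    rfl
  rw [h1, ← integral_comp_polarCoord_symm]
  rw [polarCoord_target]
  congr 1
  ext p
  simp only [polarCoord_symm_apply, smul_eq_mul]
  congr 2
  ext i; fin_cases i <;> simp [ev]

lemma polar_id (g : E2 → ℝ) (G : E2 → E2 →L[ℝ] ℝ) (Q : E2 → E2 →L[ℝ] E2 →L[ℝ] ℝ)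
    (hg : ∀ z, HasFDerivAt g (G z) z) (hG : ∀ z, HasFDerivAt G (Q z) z) (hQ : Continuous Q)
    (L C0 : ℝ) (hL : 0 < L) (hgL : ∀ z, L ≤ ‖z‖ → g z = C0) (hGL : ∀ z, L ≤ ‖z‖ → G z = 0)
    (hQL : ∀ z, L ≤ ‖z‖ → Q z = 0) :
    ∫ z, (Q z (Jr z) (Jr z) - Q z z z) / ‖z‖^2 = 4 * π * (C0 - g 0) := by
  have hGc : Continuous G := continuous_iff_continuousAt.2 fun z => (hG z).continuousAt
  have hev := continuous_ev
  have htv := continuous_tv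
  set k : ℝ × ℝ → ℝ := fun p => p.1 * (Q (p.1 • ev p.2) (tv p.2) (tv p.2)
    - Q (p.1 • ev p.2) (ev p.2) (ev p.2)) with hk
  have hkc : Continuous k := by
    have h1 : Continuous fun p : ℝ × ℝ => Q (p.1 • ev p.2) := hQ.comp (by fun_prop)
    have h2 : Continuous fun p : ℝ × ℝ => tv p.2 := by fun_prop
    have h3 : Continuous fun p : ℝ × ℝ => ev p.2 := by fun_prop
    exact continuous_fst.mul (((h1.clm_apply h2).clm_apply h2).sub ((h1.clm_apply h3).clm_apply h3))
  have hnorm : ∀ r θ : ℝ, 0 ≤ r → ‖r • ev θ‖ = r := fun r θ hr => by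
    rw [norm_smul, norm_ev, mul_one, Real.norm_of_nonneg hr]
  have s1 : ∫ z, (Q z (Jr z) (Jr z) - Q z z z) / ‖z‖^2
      = ∫ p in Set.Ioi (0:ℝ) ×ˢ Set.Ioo (-π) π, k p := by
    rw [integral_polar]
    apply setIntegral_congr_fun (measurableSet_Ioi.prod measurableSet_Ioo)
    rintro ⟨r, θ⟩ ⟨hr, -⟩
    have hr : 0 < r := hr
    simp only [hk, Jr_smul, hnorm r θ hr.le, map_smul, _root_.smul_apply, smul_eq_mul]
    field_simp
  have s2 : ∫ p in Set.Ioi (0:ℝ) ×ˢ Set.Ioo (-π) π, k p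
      = ∫ p in Set.Ioc (0:ℝ) L ×ˢ Set.Ioo (-π) π, k p := by
    apply setIntegral_eq_of_subset_of_forall_sdiff_eq_zero (measurableSet_Ioi.prod measurableSet_Ioo)
    · exact Set.prod_mono Set.Ioc_subset_Ioi_self subset_rfl
    · rintro ⟨r, θ⟩ ⟨⟨hr, hθ⟩, h2⟩
      have hr : 0 < r := hr
      have : L ≤ r := by
        by_contra hlt
        exact h2 ⟨⟨hr, (not_le.1 hlt).le⟩, hθ⟩
      have := hQL (r • ev θ) (by rw [hnorm r θ hr.le]; exact this)
      simp [hk, this]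
  have s3 : ∫ p in Set.Ioc (0:ℝ) L ×ˢ Set.Ioo (-π) π, k p
      = ∫ r in (0:ℝ)..L, ∫ θ in (-π)..π, k (r, θ) := by
    rw [Measure.volume_eq_prod, setIntegral_prod, intervalIntegral.integral_of_le hL.le]
    · congr 1; ext r
      rw [intervalIntegral.integral_of_le (by linarith [pi_pos]), integral_Ioc_eq_integral_Ioo]
    · rw [← Measure.volume_eq_prod]
      exact (hkc.continuousOn.integrableOn_compact (isCompact_Icc.prod isCompact_Icc)).mono_set
        (Set.prod_mono Set.Ioc_subset_Icc_self Set.Ioo_subset_Icc_self)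
  set m : ℝ → ℝ → ℝ := fun r θ => G (r • ev θ) (ev θ) - r * Q (r • ev θ) (ev θ) (ev θ) with hm
  have hmc : Continuous (Function.uncurry m) := by
    have h1 : Continuous fun p : ℝ × ℝ => Q (p.1 • ev p.2) := hQ.comp (by fun_prop)
    have h2 : Continuous fun p : ℝ × ℝ => G (p.1 • ev p.2) := hGc.comp (by fun_prop)
    have h3 : Continuous fun p : ℝ × ℝ => ev p.2 := by fun_prop
    exact (h2.clm_apply h3).sub (continuous_fst.mul ((h1.clm_apply h3).clm_apply h3))
  have s4 : ∀ r : ℝ, ∫ θ in (-π)..π, k (r, θ) = ∫ θ in (-π)..π, m r θ := by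
    intro r
    have hder : ∀ θ : ℝ, HasDerivAt (fun θ => G (r • ev θ) (tv θ)) (k (r, θ) - m r θ) θ := by
      intro θ
      have h1 : HasDerivAt (fun θ => G (r • ev θ)) (Q (r • ev θ) (r • tv θ)) θ :=
        (hG (r • ev θ)).comp_hasDerivAt θ ((hasDerivAt_ev θ).const_smul r)
      refine (h1.clm_apply (hasDerivAt_tv θ)).congr_deriv ?_
      simp only [hk, hm, map_smul, map_neg, _root_.smul_apply, smul_eq_mul]
      ring
    have ck : Continuous fun θ => k (r, θ) := hkc.comp (by fun_prop)
    have cm : Continuous fun θ => m r θ := hmc.comp (f := fun θ => (r, θ)) (by fun_prop)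
    have := intervalIntegral.integral_eq_sub_of_hasDerivAt (a := -π) (b := π) (fun θ _ => hder θ)
      ((ck.sub cm).intervalIntegrable _ _)
    rw [intervalIntegral.integral_sub (ck.intervalIntegrable _ _) (cm.intervalIntegrable _ _)] at this
    have e1 : ev (-π) = ev π := by simp [ev]
    have e2 : tv (-π) = tv π := by simp [tv]
    rw [e1, e2, sub_self] at this
    linarith
  have s5 : ∀ θ : ℝ, ∫ r in (0:ℝ)..L, m r θ = 2 * (C0 - g 0) := by
    intro θ
    have hder : ∀ r : ℝ, HasDerivAt (fun r : ℝ => 2 * g (r • ev θ) - r * G (r • ev θ) (ev θ))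
        (m r θ) r := by
      intro r
      have h0 : HasDerivAt (fun r : ℝ => r • ev θ) (ev θ) r := by
        simpa using (hasDerivAt_id r).smul_const (ev θ)
      have h1 := (hG (r • ev θ)).comp_hasDerivAt r h0
      have h2 := (hg (r • ev θ)).comp_hasDerivAt r h0
      have h3 := h1.clm_apply (hasDerivAt_const r (ev θ))
      refine ((h2.const_mul 2).sub ((hasDerivAt_id r).mul h3)).congr_deriv ?_
      simp only [hm, map_zero, id, Function.comp]
      ring
    have cm : Continuous fun r => m r θ := hmc.comp (f := fun r => (r, θ)) (by fun_prop)
    rw [intervalIntegral.integral_eq_sub_of_hasDerivAt (fun r _ => hder r)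
      (cm.intervalIntegrable _ _)]
    have hLn : L ≤ ‖L • ev θ‖ := (hnorm L θ hL.le).ge
    rw [hgL _ hLn, hGL _ hLn]
    simp
    ring
  rw [s1, s2, s3]
  simp_rw [s4]
  rw [intervalIntegral_intervalIntegral_swap]
  · simp_rw [s5]
    simp
    ring
  · exact (hmc.continuousOn.integrableOn_compact (isCompact_Icc.prod isCompact_Icc)).mono_set
        (Set.prod_mono Set.uIoc_subset_uIcc Set.uIoc_subset_uIcc)

lemma integral_apply_one {E V : Type*} [NormedAddCommGroup E] [NormedSpace ℝ E]
    [NormedAddCommGroup V] [NormedSpace ℝ V]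
    (f : E2 → E →L[ℝ] V) (hf : Continuous f) (K : Set E2) (hK : IsCompact K)
    (h0 : ∀ x, x ∉ K → f x = 0) (a : E) :
    Integrable (fun x => f x a) ∧ (∫ x, f x) a = ∫ x, f x a := by
  have h : Integrable f := hf.integrable_of_hasCompactSupport (HasCompactSupport.intro hK h0)
  exact ⟨h.apply_continuousLinearMap a, ContinuousLinearMap.integral_apply h a⟩

lemma le_of_sq_le_sq_aux (a b : ℝ) (hb : 0 ≤ b) (h : a^2 ≤ b^2) : a ≤ b :=
  (le_abs_self a).trans (abs_le_of_sq_le_sq h hb)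

lemma hasFDerivAt_integral_compact {V : Type*} [NormedAddCommGroup V] [NormedSpace ℝ V]
    (F : E2 → E2 → V) (F' : E2 → E2 → E2 →L[ℝ] V)
    (hF : Continuous (Function.uncurry F)) (hF' : Continuous (Function.uncurry F'))
    (hd : ∀ z x, HasFDerivAt (fun z => F z x) (F' z x) z)
    (z₀ : E2) (K : Set E2) (hK : IsCompact K)
    (h0 : ∀ z ∈ Metric.ball z₀ 1, ∀ x, x ∉ K → F z x = 0) :
    HasFDerivAt (fun z => ∫ x, F z x) (∫ x, F' z₀ x) z₀ := by
  have h0' : ∀ z ∈ Metric.ball z₀ 1, ∀ x, x ∉ K → F' z x = 0 := by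
    intro z hz x hx
    have h1 : (fun z => F z x) =ᶠ[nhds z] fun _ => 0 :=
      Filter.eventually_of_mem (Metric.isOpen_ball.mem_nhds hz) fun w hw => h0 w hw x hx
    exact (hd z x).unique ((hasFDerivAt_const (0:V) z).congr_of_eventuallyEq h1)
  obtain ⟨C, hC⟩ := ((isCompact_closedBall z₀ 1).prod hK).exists_bound_of_continuousOn
    hF'.continuousOn
  have hz₀ : z₀ ∈ Metric.ball z₀ 1 := Metric.mem_ball_self one_pos
  have cF : ∀ z, Continuous (F z) := fun z => hF.comp (f := fun x => (z, x)) (by fun_prop)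
  have cF' : ∀ z, Continuous (F' z) := fun z => hF'.comp (f := fun x => (z, x)) (by fun_prop)
  refine hasFDerivAt_integral_of_dominated_of_fderiv_le (bound := K.indicator fun _ => C)
    (Metric.isOpen_ball.mem_nhds hz₀)
    (Filter.Eventually.of_forall fun z => (cF z).aestronglyMeasurable) ?_
    (cF' z₀).aestronglyMeasurable ?_ ?_ ?_
  · exact (cF z₀).integrable_of_hasCompactSupport (HasCompactSupport.intro hK (h0 z₀ hz₀))
  · refine Filter.Eventually.of_forall fun x z hz => ?_
    by_cases hx : x ∈ K
    · rw [Set.indicator_of_mem hx]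
      exact hC (z, x) ⟨Metric.ball_subset_closedBall hz, hx⟩
    · rw [Set.indicator_of_notMem hx, h0' z hz x hx, norm_zero]
  · exact (integrable_indicator_iff hK.measurableSet).2
      (integrableOn_const hK.measure_lt_top.ne)
  · exact Filter.Eventually.of_forall fun x z _ => hd z x

lemma clm_coord (p : E2 →L[ℝ] ℝ) (z : E2) :
    p z = z 0 * p (EuclideanSpace.single 0 1) + z 1 * p (EuclideanSpace.single 1 1) := by
  have : z = z 0 • EuclideanSpace.single 0 (1:ℝ) + z 1 • EuclideanSpace.single 1 (1:ℝ) := by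
    ext i; fin_cases i <;> simp
  conv_lhs => rw [this]
  simp

/-- Euclidean length of the gradient. -/
noncomputable def gn (v : E2 → ℝ) (x : E2) : ℝ :=
  √((fderiv ℝ v x (EuclideanSpace.single 0 1))^2 + (fderiv ℝ v x (EuclideanSpace.single 1 1))^2)

lemma refl_ineq (p q : E2 →L[ℝ] ℝ) (z : E2) :
    |(p (Jr z) * q (Jr z) - p z * q z) / ‖z‖^2| ≤
      √((p (EuclideanSpace.single 0 1))^2 + (p (EuclideanSpace.single 1 1))^2) *
      √((q (EuclideanSpace.single 0 1))^2 + (q (EuclideanSpace.single 1 1))^2) := by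
  rw [← Real.sqrt_mul (by positivity), abs_div, abs_of_nonneg (sq_nonneg ‖z‖)]
  apply div_le_of_le_mul₀ (by positivity) (by positivity)
  have hz : ‖z‖^2 = z 0 ^2 + z 1 ^2 := by
    rw [EuclideanSpace.norm_sq_eq]; simp
  rw [clm_coord p (Jr z), clm_coord q (Jr z), clm_coord p z, clm_coord q z, hz]
  have j0 : Jr z 0 = - z 1 := by simp [Jr]
  have j1 : Jr z 1 = z 0 := by simp [Jr]
  rw [j0, j1]
  generalize p (EuclideanSpace.single 0 1) = a
  generalize p (EuclideanSpace.single 1 1) = b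
  generalize q (EuclideanSpace.single 0 1) = c
  generalize q (EuclideanSpace.single 1 1) = d
  generalize z 0 = s
  generalize z 1 = t
  refine abs_le_of_sq_le_sq ?_ (by positivity)
  rw [mul_pow, Real.sq_sqrt (by positivity)]
  nlinarith [sq_nonneg ((t^2 - s^2) * (a * d + b * c) + 2 * s * t * (a * c - b * d))]

lemma key_ineq {v : E2 → ℝ} {A Θ κ : ℝ → ℝ}
    (hv : ContDiff ℝ (⊤ : ℕ∞) v) (hsupp : HasCompactSupport v)
    (hA : ∀ a, HasDerivAt A (Θ a) a) (hΘ : ∀ a, HasDerivAt Θ (κ a) a) (hκ : Continuous κ)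
    (hA0 : A 0 = 0) (hAe : ∀ a, A (-a) = A a) (hκ0 : ∀ a, 0 ≤ κ a) :
    8 * π * ∫ x, A (v x) ≤ ∫ x, ∫ y, κ (v y - v x) * gn v y * gn v x := by
  have cv : Continuous v := hv.continuous
  have dv : ∀ x, HasFDerivAt v (fderiv ℝ v x) x := fun x =>
    (hv.differentiable (by simp) x).hasFDerivAt
  have cdv : Continuous (fderiv ℝ v) := hv.continuous_fderiv (by simp)
  have cA : Continuous A := continuous_iff_continuousAt.2 fun a => (hA a).continuousAt
  have cΘ : Continuous Θ := continuous_iff_continuousAt.2 fun a => (hΘ a).continuousAt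
  set S := tsupport v with hS
  have hSc : IsCompact S := hsupp
  have v0 : ∀ x, x ∉ S → v x = 0 := fun x hx => image_eq_zero_of_notMem_tsupport hx
  have dv0 : ∀ x, x ∉ S → fderiv ℝ v x = 0 := fun x hx => by
    by_contra h
    exact hx (support_fderiv_subset ℝ h)
  obtain ⟨B, hBpos, hB⟩ : ∃ B > 0, ∀ x ∈ S, ‖x‖ ≤ B := by
    obtain ⟨B, hB⟩ := hSc.isBounded.exists_norm_le
    exact ⟨max B 1, by positivity, fun x hx => (hB x hx).trans (le_max_left _ _)⟩
  set g : E2 → ℝ := fun z => ∫ x, A (v x - v (x - z)) with hg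
  set G : E2 → E2 →L[ℝ] ℝ := fun z => ∫ x, Θ (v (x + z) - v x) • fderiv ℝ v x with hG
  set Q : E2 → E2 →L[ℝ] E2 →L[ℝ] ℝ := fun z =>
    ∫ x, (κ (v (x + z) - v x) • fderiv ℝ v (x + z)).smulRight (fderiv ℝ v x) with hQ
  have cQi : Continuous (Function.uncurry fun z x : E2 =>
      (κ (v (x + z) - v x) • fderiv ℝ v (x + z)).smulRight (fderiv ℝ v x)) := by
    have h1 : Continuous fun p : E2 × E2 => κ (v (p.2 + p.1) - v p.2) • fderiv ℝ v (p.2 + p.1) :=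
      by fun_prop
    have h2 : Continuous fun p : E2 × E2 => fderiv ℝ v p.2 := by fun_prop
    exact ((ContinuousLinearMap.smulRightL ℝ E2 (E2 →L[ℝ] ℝ)).continuous.comp h1).clm_apply h2
  have dg : ∀ z, HasFDerivAt g (G z) z := by
    intro z
    have h1 := hasFDerivAt_integral_compact (fun z x => A (v x - v (x - z)))
      (fun z x => Θ (v x - v (x - z)) • fderiv ℝ v (x - z)) (by fun_prop) (by fun_prop) ?_ z
      (Metric.closedBall 0 (B + ‖z‖ + 1)) (isCompact_closedBall _ _) ?_
    · refine h1.congr_fderiv ?_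
      rw [hG]
      simp only
      rw [← integral_add_right_eq_self _ z]
      simp
    · intro z x
      have h2 : HasFDerivAt (fun z => v x - v (x - z)) (fderiv ℝ v (x - z)) z := by
        have := (((dv (x - z)).comp z ((hasFDerivAt_id z).const_sub x)).const_sub (v x))
        refine this.congr_fderiv ?_
        ext; simp
      exact (hA _).comp_hasFDerivAt z h2
    · intro w hw x hx
      simp only [Metric.mem_closedBall, dist_zero_right, not_le, Metric.mem_ball] at hx hw
      have hw2 : ‖w‖ ≤ ‖z‖ + 1 := by
        have := norm_le_norm_add_norm_sub' w z
        rw [dist_eq_norm] at hw; linarith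
      have h1 : x ∉ S := fun h => by have := hB x h; linarith [norm_nonneg z]
      have h2 : x - w ∉ S := fun h => by
        have := hB _ h
        have := norm_le_norm_add_norm_sub' x w
        linarith
      simp [v0 _ h1, v0 _ h2, hA0]
  have dG : ∀ z, HasFDerivAt G (Q z) z := by
    intro z
    refine hasFDerivAt_integral_compact (fun z x => Θ (v (x + z) - v x) • fderiv ℝ v x)
      _ (by fun_prop) cQi ?_ z S hSc ?_
    · intro z x
      have h2 : HasFDerivAt (fun z => v (x + z) - v x) (fderiv ℝ v (x + z)) z := by
        have := ((dv (x + z)).comp z ((hasFDerivAt_id z).const_add x)).sub_const (v x)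
        exact this
      exact ((hΘ _).comp_hasFDerivAt z h2).smul_const (fderiv ℝ v x)
    · intro w _ x hx
      simp [dv0 x hx]
  have cQ : Continuous Q := by
    have : Q = fun z => ∫ x in S,
        (κ (v (x + z) - v x) • fderiv ℝ v (x + z)).smulRight (fderiv ℝ v x) := by
      ext1 z
      symm
      apply setIntegral_eq_integral_of_forall_compl_eq_zero
      intro x hx; ext; simp [dv0 x hx]
    rw [this]
    exact continuous_parametric_integral_of_continuous cQi hSc
  have far : ∀ z : E2, 2 * B < ‖z‖ → ∀ x, x ∈ S → x + z ∉ S := by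
    intro z hz x hx h
    have h1 := hB _ hx
    have h2 := hB _ h
    have h3 : ‖z‖ ≤ ‖x + z‖ + ‖x‖ := by
      simpa using norm_sub_le (x + z) x
    linarith
  have iA : Integrable fun x => A (v x) :=
    (cA.comp cv).integrable_of_hasCompactSupport
      (HasCompactSupport.intro hSc fun x hx => by simp [v0 x hx, hA0])
  have hgL : ∀ z, 2 * B < ‖z‖ → g z = 2 * ∫ x, A (v x) := by
    intro z hz
    have h1 : ∀ x, A (v x - v (x - z)) = A (v x) + A (v (x - z)) := by
      intro x
      by_cases hx : x - z ∈ S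
      · have := far z hz _ hx
        rw [sub_add_cancel] at this
        simp [v0 x this, hA0, hAe]
      · simp [v0 _ hx, hA0]
    rw [hg]
    simp only [h1]
    rw [integral_add iA (iA.comp_sub_right z), integral_sub_right_eq_self (fun x => A (v x)) z]
    ring
  have hGL : ∀ z, 3 * B ≤ ‖z‖ → G z = 0 := by
    intro z hz
    have h1 : g =ᶠ[nhds z] fun _ => 2 * ∫ x, A (v x) :=
      Filter.eventually_of_mem ((isOpen_lt continuous_const continuous_norm).mem_nhds
        (show 2 * B < ‖z‖ by linarith)) hgL
    exact (dg z).unique ((hasFDerivAt_const _ z).congr_of_eventuallyEq h1)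
  have hQL : ∀ z, 3 * B ≤ ‖z‖ → Q z = 0 := by
    intro z hz
    rw [hQ]
    refine integral_eq_zero_of_ae (Filter.Eventually.of_forall fun x => ?_)
    by_cases hx : x ∈ S
    · have := far z (by linarith) x hx
      ext; simp [dv0 _ this]
    · ext; simp [dv0 _ hx]
  have hpol := polar_id g G Q dg dG cQ (3 * B) (2 * ∫ x, A (v x)) (by positivity)
    (fun z hz => hgL z (by linarith)) hGL hQL
  have hg0 : g 0 = 0 := by simp [hg, hA0]
  rw [hg0] at hpol
  have cgn : Continuous (gn v) := by unfold gn; fun_prop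
  have gn0 : ∀ x, x ∉ S → gn v x = 0 := fun x hx => by simp [gn, dv0 x hx]
  set W : E2 × E2 → ℝ := fun p => κ (v (p.2 + p.1) - v p.2) * gn v (p.2 + p.1) * gn v p.2 with hW
  have cW : Continuous W := by fun_prop
  have iW : Integrable W (volume.prod volume) := by
    rw [← Measure.volume_eq_prod]
    refine cW.integrable_of_hasCompactSupport (HasCompactSupport.intro
      ((isCompact_closedBall (0:E2) (3 * B)).prod hSc) ?_)
    rintro ⟨z, x⟩ hzx
    by_cases hx : x ∈ S
    · have : 3 * B ≤ ‖z‖ := by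
        by_contra h
        exact hzx ⟨by simpa using (not_le.1 h).le, hx⟩
      simp [hW, gn0 _ (far z (by linarith) x hx)]
    · simp [hW, gn0 _ hx]
  have cQz : ∀ z, Continuous fun x =>
      (κ (v (x + z) - v x) • fderiv ℝ v (x + z)).smulRight (fderiv ℝ v x) := fun z =>
    cQi.comp (f := fun x => (z, x)) (by fun_prop)
  set Fq : E2 → E2 → (E2 →L[ℝ] E2 →L[ℝ] ℝ) := fun z x =>
      (κ (v (x + z) - v x) • fderiv ℝ v (x + z)).smulRight (fderiv ℝ v x) with hFq
  have iQ1 := fun z a => integral_apply_one (Fq z) (cQz z) S hSc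
    (fun x hx => by ext; simp [hFq, dv0 x hx]) a
  have iQ2 := fun z a => integral_apply_one (fun x => Fq z x a)
    ((cQz z).clm_apply continuous_const) S hSc (fun x hx => by ext; simp [hFq, dv0 x hx]) a
  have iq : ∀ z a, Integrable fun x =>
      κ (v (x + z) - v x) * ((fderiv ℝ v (x + z) a) * fderiv ℝ v x a) := fun z a => by
    simpa [hFq, mul_assoc] using (iQ2 z a).1
  have hQap : ∀ z a, Q z a a =
      ∫ x, κ (v (x + z) - v x) * ((fderiv ℝ v (x + z) a) * fderiv ℝ v x a) := by
    intro z a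
    have h1 : Q z a = ∫ x, Fq z x a := (iQ1 z a).2
    rw [h1, (iQ2 z a).2]
    simp [hFq, mul_assoc]
  have hle : ∀ z, |(Q z (Jr z) (Jr z) - Q z z z) / ‖z‖^2| ≤ ∫ x, W (z, x) := by
    intro z
    rw [hQap, hQap, ← integral_sub (iq _ _) (iq _ _), ← integral_div, ← Real.norm_eq_abs]
    apply norm_integral_le_of_norm_le
    · refine Continuous.integrable_of_hasCompactSupport (by fun_prop)
        (HasCompactSupport.intro hSc fun x hx => ?_)
      simp [hW, gn0 _ hx]
    · refine Filter.Eventually.of_forall fun x => ?_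
      have h1 := refl_ineq (fderiv ℝ v (x + z)) (fderiv ℝ v x) z
      have h2 := mul_le_mul_of_nonneg_left h1 (hκ0 (v (x + z) - v x))
      rw [← mul_sub, mul_div_assoc, Real.norm_eq_abs, abs_mul, abs_of_nonneg (hκ0 _)]
      simp only [hW, gn]
      rw [mul_assoc]
      exact h2
  have cJ : Continuous Jr := by unfold Jr; fun_prop
  have hInteg : Integrable fun z => (Q z (Jr z) (Jr z) - Q z z z) / ‖z‖^2 := by
    refine iW.integral_prod_left.mono' ?_ (Filter.Eventually.of_forall fun z => hle z)
    have c1 : Continuous fun z => Q z (Jr z) (Jr z) - Q z z z :=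
      ((cQ.clm_apply cJ).clm_apply cJ).sub ((cQ.clm_apply continuous_id).clm_apply continuous_id)
    have c2 : Continuous fun z : E2 => ‖z‖^2 := by fun_prop
    exact (c1.measurable.div c2.measurable).aestronglyMeasurable
  calc 8 * π * ∫ x, A (v x) = ∫ z, (Q z (Jr z) (Jr z) - Q z z z) / ‖z‖^2 := by rw [hpol]; ring
    _ ≤ ∫ z, ∫ x, W (z, x) := integral_mono hInteg iW.integral_prod_left
        fun z => (le_abs_self _).trans (hle z)
    _ = ∫ x, ∫ z, W (z, x) := integral_integral_swap iW
    _ = _ := by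
      congr 1; ext x
      rw [← integral_add_left_eq_self (fun y => κ (v y - v x) * gn v y * gn v x) x]

lemma bdd_integrable {X : Type*} [MeasurableSpace X] {μ : Measure X} [IsFiniteMeasure μ]
    (f : X → ℝ) (hf : Measurable f) (C : ℝ) (h : ∀ x, |f x| ≤ C) : Integrable f μ :=
  Integrable.of_bound hf.aestronglyMeasurable C (Filter.Eventually.of_forall h)

lemma triple_ineq {X : Type*} [MeasurableSpace X] (μ : Measure X) [IsFiniteMeasure μ]
    (k : X → X → ℝ) (hk : Measurable (Function.uncurry k)) (hb : ∀ x y, |k x y| ≤ 1/2)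
    (h3 : ∀ a b c, k a b * k a c + k b a * k b c + k c a * k c b ≤ 1/4) :
    Measurable (fun a => ∫ b, k a b ∂μ) ∧ (∀ a, |∫ b, k a b ∂μ| ≤ 1/2 * μ.real Set.univ) ∧
    ∫ a, (∫ b, k a b ∂μ)^2 ∂μ ≤ (μ.real Set.univ)^3 / 12 := by
  set M := μ.real Set.univ with hM
  have hM0 : 0 ≤ M := measureReal_nonneg
  set Φ : X → ℝ := fun a => ∫ b, k a b ∂μ with hΦ
  have mΦ : Measurable Φ := (hk.stronglyMeasurable.integral_prod_right').measurable
  have m1 : ∀ a, Measurable (k a) := fun a => hk.comp measurable_prodMk_left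
  have m2 : ∀ a, Measurable (fun b => k b a) := fun a => hk.comp measurable_prodMk_right
  have bΦ : ∀ a, |Φ a| ≤ 1/2 * M := fun a =>
    norm_integral_le_of_norm_le_const (f := fun b => k a b) (μ := μ)
      (Filter.Eventually.of_forall fun b => hb a b)
  refine ⟨mΦ, bΦ, ?_⟩
  have b2 : ∀ a b c d, |k a b * k c d| ≤ 1/4 := fun a b c d => by
    rw [abs_mul]
    calc _ ≤ (1/2:ℝ) * (1/2) := mul_le_mul (hb _ _) (hb _ _) (abs_nonneg _) (by norm_num)
      _ = _ := by norm_num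
  have b3 : ∀ a b c, |k a b * Φ c| ≤ 1/4 * M := fun a b c => by
    rw [abs_mul]
    calc _ ≤ (1/2:ℝ) * (1/2 * M) := mul_le_mul (hb _ _) (bΦ _) (abs_nonneg _) (by norm_num)
      _ = _ := by ring
  set P : X → ℝ := fun a => ∫ b, k b a * Φ b ∂μ with hP
  have mkP : Measurable (Function.uncurry fun a b => k b a * Φ b) :=
    (hk.comp measurable_swap).mul (mΦ.comp measurable_snd)
  have mP : Measurable P := mkP.stronglyMeasurable.integral_prod_right'.measurable
  have bP : ∀ a, |P a| ≤ 1/4 * M * M := fun a =>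
    norm_integral_le_of_norm_le_const (f := fun b => k b a * Φ b) (μ := μ)
      (Filter.Eventually.of_forall fun b => b3 b a b)
  have s1 : ∀ a b, k a b * Φ a + k b a * Φ b + ∫ c, k c a * k c b ∂μ ≤ 1/4 * M := by
    intro a b
    have i1 : Integrable (fun c => k a b * k a c) μ :=
      bdd_integrable _ ((m1 a).const_mul _) _ fun c => b2 _ _ _ _
    have i2 : Integrable (fun c => k b a * k b c) μ :=
      bdd_integrable _ ((m1 b).const_mul _) _ fun c => b2 _ _ _ _
    have i3 : Integrable (fun c => k c a * k c b) μ :=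
      bdd_integrable _ ((m2 a).mul (m2 b)) _ fun c => b2 _ _ _ _
    have := integral_mono ((i1.add i2).add i3) (integrable_const (1/4:ℝ)) (fun c => h3 a b c)
    rw [integral_add' (i1.add i2) i3, integral_add' i1 i2, integral_const_mul,
      integral_const_mul, integral_const] at this
    simp only [smul_eq_mul] at this
    linarith
  have mN : Measurable (Function.uncurry fun (p : X × X) c => k c p.1 * k c p.2) :=
    (hk.comp (measurable_snd.prodMk (measurable_fst.comp measurable_fst))).mul
      (hk.comp (measurable_snd.prodMk (measurable_snd.comp measurable_fst)))
  have mN' : Measurable fun p : X × X => ∫ c, k c p.1 * k c p.2 ∂μ :=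
    mN.stronglyMeasurable.integral_prod_right'.measurable
  have bN : ∀ a b, |∫ c, k c a * k c b ∂μ| ≤ 1/4 * M := fun a b =>
    norm_integral_le_of_norm_le_const (f := fun c => k c a * k c b) (μ := μ)
      (Filter.Eventually.of_forall fun c => b2 c a c b)
  have s2 : ∀ a, Φ a ^2 + 2 * P a ≤ 1/4 * M * M := by
    intro a
    have i1 : Integrable (fun b => k a b * Φ a) μ :=
      bdd_integrable _ ((m1 a).mul_const _) _ fun c => b3 _ _ _
    have i2 : Integrable (fun b => k b a * Φ b) μ :=
      bdd_integrable _ ((m2 a).mul mΦ) _ fun c => b3 _ _ _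
    have i3 : Integrable (fun b => ∫ c, k c a * k c b ∂μ) μ :=
      bdd_integrable _ (mN'.comp measurable_prodMk_left) _ fun c => bN _ _
    have hsw : ∫ b, ∫ c, k c a * k c b ∂μ ∂μ = P a := by
      rw [integral_integral_swap]
      · simp only [integral_const_mul]; rfl
      · exact bdd_integrable _ (((m2 a).comp measurable_snd).mul (hk.comp measurable_swap)) _
          fun p => b2 _ _ _ _
    have := integral_mono ((i1.add i2).add i3) (integrable_const (1/4 * M)) (fun b => s1 a b)
    rw [integral_add' (i1.add i2) i3, integral_add' i1 i2, integral_mul_const, hsw,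
      integral_const] at this
    simp only [smul_eq_mul] at this
    have e1 : ∫ b, k a b ∂μ = Φ a := rfl
    have e2 : ∫ b, k b a * Φ b ∂μ = P a := rfl
    rw [e1, e2] at this
    nlinarith
  have iΦ2 : Integrable (fun a => Φ a ^ 2) μ := by
    refine bdd_integrable _ (mΦ.pow_const 2) ((1/2 * M)^2) fun a => ?_
    rw [abs_pow]
    exact pow_le_pow_left₀ (abs_nonneg _) (bΦ a) 2
  have iP : Integrable P μ := bdd_integrable _ mP _ bP
  have hPP : ∫ a, P a ∂μ = ∫ a, Φ a ^2 ∂μ := by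
    rw [hP, integral_integral_swap]
    · simp only [integral_mul_const]
      congr 1; ext a; rw [sq]
    · exact bdd_integrable _ mkP _ fun p => b3 _ _ _
  have := integral_mono (iΦ2.add (iP.const_mul 2)) (integrable_const (1/4 * M * M))
    (fun a => s2 a)
  rw [integral_add' iΦ2 (iP.const_mul 2), integral_const_mul, hPP, integral_const] at this
  simp only [smul_eq_mul] at this
  nlinarith

lemma tri_ordered (p q r : ℝ) (hp : 0 ≤ p) (hq : 0 ≤ q) (hpr : p ≤ r) (hqr : q ≤ r)
    (hr : r ≤ 1/2) : r * (p + q) - p * q ≤ 1/4 := by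
  nlinarith [mul_nonneg (sub_nonneg.2 (hpr.trans hr)) (sub_nonneg.2 (hqr.trans hr)),
    mul_nonneg (add_nonneg hp hq) (sub_nonneg.2 hr)]

lemma tri_kernel (Θ : ℝ → ℝ) (hm : Monotone Θ) (ho : ∀ a, Θ (-a) = -Θ a)
    (hb : ∀ a, |Θ a| ≤ 1/2) (a b c : ℝ) :
    Θ (a - b) * Θ (a - c) + Θ (b - a) * Θ (b - c) + Θ (c - a) * Θ (c - b) ≤ 1/4 := by
  have h0 : Θ 0 = 0 := by have := ho 0; simp at this; linarith
  have main : ∀ a b c : ℝ, b ≤ a → c ≤ b →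
      Θ (a - b) * Θ (a - c) + Θ (b - a) * Θ (b - c) + Θ (c - a) * Θ (c - b) ≤ 1/4 := by
    intro a b c hab hbc
    have e1 : Θ (b - a) = - Θ (a - b) := by rw [← ho]; congr 1; ring
    have e2 : Θ (c - a) = - Θ (a - c) := by rw [← ho]; congr 1; ring
    have e3 : Θ (c - b) = - Θ (b - c) := by rw [← ho]; congr 1; ring
    rw [e1, e2, e3]
    have := tri_ordered (Θ (a - b)) (Θ (b - c)) (Θ (a - c))
      (h0 ▸ hm (by linarith)) (h0 ▸ hm (by linarith)) (hm (by linarith)) (hm (by linarith))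
      ((le_abs_self _).trans (hb _))
    linarith
  rcases le_total a b with h1 | h1 <;> rcases le_total b c with h2 | h2 <;>
    rcases le_total a c with h3 | h3
  · linarith [main c b a h2 h1]
  · linarith [main c b a h2 h1]
  · linarith [main b c a h2 h3]
  · linarith [main b a c h1 h3]
  · linarith [main c a b h3 h1]
  · linarith [main a c b h3 h2]
  · linarith [main a b c h1 h2]
  · linarith [main a b c h1 h2]

lemma green_ident {v : E2 → ℝ} {Θ κ : ℝ → ℝ}
    (hv : ContDiff ℝ (⊤ : ℕ∞) v) (hsupp : HasCompactSupport v)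
    (hΘ : ∀ a, HasDerivAt Θ (κ a) a) (hκ : Continuous κ) (b : ℝ) :
    ∫ y, κ (v y - b) * gn v y ^ 2 = - ∫ y, Θ (v y - b) * laplacian v y := by
  have cv : Continuous v := hv.continuous
  have dv : ∀ x, HasFDerivAt v (fderiv ℝ v x) x := fun x =>
    (hv.differentiable (by simp) x).hasFDerivAt
  have cΘ : Continuous Θ := continuous_iff_continuousAt.2 fun a => (hΘ a).continuousAt
  have hfd : ContDiff ℝ (⊤ : ℕ∞) (fderiv ℝ v) := hv.fderiv_right (by simp)
  have cdv : Continuous (fderiv ℝ v) := hfd.continuous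
  have dv0 : ∀ x, x ∉ tsupport v → fderiv ℝ v x = 0 := fun x hx => by
    by_contra h
    exact hx (support_fderiv_subset ℝ h)
  have hfe : ∀ e : E2, ContDiff ℝ (⊤ : ℕ∞) (fun y => fderiv ℝ v y e) := fun e =>
    hfd.clm_apply contDiff_const
  have d2 : ∀ e x, x ∉ tsupport v → fderiv ℝ (fun y => fderiv ℝ v y e) x = 0 := fun e x hx => by
    have h1 : (fun y => fderiv ℝ v y e) =ᶠ[nhds x] fun _ => 0 :=
      Filter.eventually_of_mem ((isClosed_tsupport v).isOpen_compl.mem_nhds hx)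
        fun w hw => by simp [dv0 w hw]
    exact ((hasFDerivAt_const (0:ℝ) x).congr_of_eventuallyEq h1).fderiv
  have cd2 : ∀ e : E2, Continuous (fderiv ℝ (fun y => fderiv ℝ v y e)) := fun e =>
    (hfe e).continuous_fderiv (by simp)
  have dT : ∀ x, HasFDerivAt (fun y => Θ (v y - b)) (κ (v x - b) • fderiv ℝ v x) x := fun x =>
    (hΘ _).comp_hasFDerivAt x ((dv x).sub_const b)
  have i1 : ∀ e : E2, Integrable fun y => κ (v y - b) * (fderiv ℝ v y e * fderiv ℝ v y e) :=
    fun e => Continuous.integrable_of_hasCompactSupport (by fun_prop)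
      (HasCompactSupport.intro hsupp fun x hx => by simp [dv0 x hx])
  have i2 : ∀ e : E2, Integrable fun y => Θ (v y - b) * fderiv ℝ (fun y => fderiv ℝ v y e) y e :=
    fun e => Continuous.integrable_of_hasCompactSupport
      ((by fun_prop : Continuous fun y => Θ (v y - b)).mul ((cd2 e).clm_apply continuous_const))
      (HasCompactSupport.intro hsupp fun x hx => by simp [d2 e x hx])
  have i3 : ∀ e : E2, Integrable fun y => Θ (v y - b) * fderiv ℝ v y e :=
    fun e => Continuous.integrable_of_hasCompactSupport (by fun_prop)
      (HasCompactSupport.intro hsupp fun x hx => by simp [dv0 x hx])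
  have key : ∀ e : E2, ∫ y, κ (v y - b) * (fderiv ℝ v y e * fderiv ℝ v y e) =
      - ∫ y, Θ (v y - b) * fderiv ℝ (fun y => fderiv ℝ v y e) y e := by
    intro e
    have hfd1 : ∀ x, fderiv ℝ (fun y => Θ (v y - b)) x e * fderiv ℝ v x e =
        κ (v x - b) * (fderiv ℝ v x e * fderiv ℝ v x e) := fun x => by
      rw [(dT x).fderiv]; simp [mul_assoc]
    have := integral_mul_fderiv_eq_neg_fderiv_mul_of_integrable (μ := (volume : Measure E2))
      (f := fun y => Θ (v y - b)) (g := fun y => fderiv ℝ v y e) (v := e)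
      (by simp only [hfd1]; exact i1 e) (i2 e) (i3 e) (fun x _ => (dT x).differentiableAt)
      (fun x _ => (hfe e).differentiable (by simp) x)
    simp only [hfd1] at this
    rw [this, neg_neg]
  have hL : ∀ y, Θ (v y - b) * laplacian v y =
      Θ (v y - b) * fderiv ℝ (fun y => fderiv ℝ v y (EuclideanSpace.single 0 1)) y
        (EuclideanSpace.single 0 1) +
      Θ (v y - b) * fderiv ℝ (fun y => fderiv ℝ v y (EuclideanSpace.single 1 1)) y
        (EuclideanSpace.single 1 1) := fun y => by
    rw [laplacian, Fin.sum_univ_two]; ring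
  have hG : ∀ y, κ (v y - b) * gn v y ^ 2 =
      κ (v y - b) * (fderiv ℝ v y (EuclideanSpace.single 0 1) *
        fderiv ℝ v y (EuclideanSpace.single 0 1)) +
      κ (v y - b) * (fderiv ℝ v y (EuclideanSpace.single 1 1) *
        fderiv ℝ v y (EuclideanSpace.single 1 1)) := fun y => by
    rw [gn, Real.sq_sqrt (by positivity)]; ring
  simp only [hL, hG]
  rw [integral_add (i1 _) (i1 _), integral_add (i2 _) (i2 _), key, key]
  ring

lemma laplacian_props {v : E2 → ℝ} (hv : ContDiff ℝ (⊤ : ℕ∞) v) :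
    Continuous (laplacian v) ∧ ∀ x, x ∉ tsupport v → laplacian v x = 0 := by
  have hfd : ContDiff ℝ (⊤ : ℕ∞) (fderiv ℝ v) := hv.fderiv_right (by simp)
  have dv0 : ∀ x, x ∉ tsupport v → fderiv ℝ v x = 0 := fun x hx => by
    by_contra h
    exact hx (support_fderiv_subset ℝ h)
  have hfe : ∀ e : E2, ContDiff ℝ (⊤ : ℕ∞) (fun y => fderiv ℝ v y e) := fun e =>
    hfd.clm_apply contDiff_const
  have d2 : ∀ e x, x ∉ tsupport v → fderiv ℝ (fun y => fderiv ℝ v y e) x = 0 := fun e x hx => by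
    have h1 : (fun y => fderiv ℝ v y e) =ᶠ[nhds x] fun _ => 0 :=
      Filter.eventually_of_mem ((isClosed_tsupport v).isOpen_compl.mem_nhds hx)
        fun w hw => by simp [dv0 w hw]
    exact ((hasFDerivAt_const (0:ℝ) x).congr_of_eventuallyEq h1).fderiv
  have cd2 : ∀ e : E2, Continuous (fderiv ℝ (fun y => fderiv ℝ v y e)) := fun e =>
    (hfe e).continuous_fderiv (by simp)
  constructor
  · unfold laplacian
    exact continuous_finsetSum _ fun i _ => (cd2 _).clm_apply continuous_const
  · intro x hx
    simp [laplacian, d2 _ x hx]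

lemma eps_bound (ε : ℝ) (hε : 0 < ε) (Ω : Set E2) (hΩ : IsOpen Ω) (hfin : volume Ω ≠ ⊤)
    (v : E2 → ℝ) (hv : ContDiff ℝ (⊤ : ℕ∞) v) (hsupp : HasCompactSupport v)
    (hsub : tsupport v ⊆ Ω) :
    4 * π * ((∫ x, |v x|) - ε * volume.real Ω) ≤
      2 * π * (∫ x, (laplacian v x)^2) + (volume.real Ω)^3 / (96 * π) := by
  obtain ⟨A, Θ, κ, hA, hΘ, hκ, hA0, hAe, hΘo, hκe, hκ0, ⟨C, hC⟩, hΘb, hAl⟩ := exists_kernel ε hε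
  have key := key_ineq hv hsupp hA hΘ hκ hA0 hAe hκ0
  set μ : Measure E2 := volume.restrict Ω with hμ
  have : IsFiniteMeasure μ := ⟨by rw [hμ, Measure.restrict_apply_univ]; exact hfin.lt_top⟩
  have cv : Continuous v := hv.continuous
  have cA : Continuous A := continuous_iff_continuousAt.2 fun a => (hA a).continuousAt
  have cΘ : Continuous Θ := continuous_iff_continuousAt.2 fun a => (hΘ a).continuousAt
  have cdv : Continuous (fderiv ℝ v) := hv.continuous_fderiv (by simp)
  have v0 : ∀ x, x ∉ Ω → v x = 0 := fun x hx =>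
    image_eq_zero_of_notMem_tsupport fun h => hx (hsub h)
  have dv0 : ∀ x, x ∉ tsupport v → fderiv ℝ v x = 0 := fun x hx => by
    by_contra h
    exact hx (support_fderiv_subset ℝ h)
  have cgn : Continuous (gn v) := by unfold gn; fun_prop
  have gn0 : ∀ x, x ∉ tsupport v → gn v x = 0 := fun x hx => by simp [gn, dv0 x hx]
  have gnO : ∀ x, x ∉ Ω → gn v x = 0 := fun x hx => gn0 x fun h => hx (hsub h)
  obtain ⟨cL, hL0⟩ := laplacian_props hv
  have LO : ∀ x, x ∉ Ω → laplacian v x = 0 := fun x hx => hL0 x fun h => hx (hsub h)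
  obtain ⟨D, hD⟩ := (HasCompactSupport.intro hsupp gn0).exists_bound_of_continuous cgn
  obtain ⟨D', hD'⟩ := (HasCompactSupport.intro hsupp hL0).exists_bound_of_continuous cL
  have hD0 : 0 ≤ D := (norm_nonneg _).trans (hD 0)
  have hC0 : 0 ≤ C := (hκ0 0).trans (hC 0)
  have hΘm : Monotone Θ := monotone_of_hasDerivAt_nonneg hΘ hκ0
  -- restrict to Ω
  have r1 : ∫ x, ∫ y, κ (v y - v x) * gn v y * gn v x
      = ∫ x, ∫ y, κ (v y - v x) * gn v y * gn v x ∂μ ∂μ := by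
    rw [hμ, setIntegral_eq_integral_of_forall_compl_eq_zero]
    · congr 1; ext x
      rw [setIntegral_eq_integral_of_forall_compl_eq_zero]
      intro y hy; simp [gnO y hy]
    · intro x hx; simp [gnO x hx]
  have kb : ∀ (a p q : ℝ), |p| ≤ D → |q| ≤ D → |κ a * p * q| ≤ C * D * D := by
    intro a p q hp hq
    rw [abs_mul, abs_mul, abs_of_nonneg (hκ0 a)]
    gcongr
    exact hC a
  have cw1 : Continuous fun p : E2 × E2 => κ (v p.2 - v p.1) * gn v p.2 * gn v p.1 := by fun_prop
  have cw2 : Continuous fun p : E2 × E2 => κ (v p.2 - v p.1) * gn v p.2 * gn v p.2 := by fun_prop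
  have cw3 : Continuous fun p : E2 × E2 => κ (v p.2 - v p.1) * gn v p.1 * gn v p.1 := by fun_prop
  have j1 : Integrable (fun p : E2 × E2 => κ (v p.2 - v p.1) * gn v p.2 * gn v p.1) (μ.prod μ) :=
    bdd_integrable _ cw1.measurable _ fun p => kb _ _ _ (hD _) (hD _)
  have j2 : Integrable (fun p : E2 × E2 => κ (v p.2 - v p.1) * gn v p.2 * gn v p.2) (μ.prod μ) :=
    bdd_integrable _ cw2.measurable _ fun p => kb _ _ _ (hD _) (hD _)
  have j3 : Integrable (fun p : E2 × E2 => κ (v p.2 - v p.1) * gn v p.1 * gn v p.1) (μ.prod μ) :=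
    bdd_integrable _ cw3.measurable _ fun p => kb _ _ _ (hD _) (hD _)
  have e3 : ∫ p : E2 × E2, κ (v p.2 - v p.1) * gn v p.1 * gn v p.1 ∂(μ.prod μ) =
      ∫ p : E2 × E2, κ (v p.2 - v p.1) * gn v p.2 * gn v p.2 ∂(μ.prod μ) := by
    rw [← integral_prod_swap]
    congr 1; ext p
    simp only [Prod.fst_swap, Prod.snd_swap]
    rw [← hκe, neg_sub]
  have r2 : ∫ x, ∫ y, κ (v y - v x) * gn v y * gn v x ∂μ ∂μ ≤
      ∫ p : E2 × E2, κ (v p.2 - v p.1) * gn v p.2 * gn v p.2 ∂(μ.prod μ) := by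
    rw [← integral_prod _ j1]
    have := integral_mono (j1.const_mul 2) (j2.add j3) (fun p => by
      simp only [Pi.add_apply]
      nlinarith [mul_nonneg (hκ0 (v p.2 - v p.1)) (sq_nonneg (gn v p.2 - gn v p.1))])
    rw [integral_add' j2 j3, integral_const_mul, e3] at this
    linarith
  have r3 : ∫ p : E2 × E2, κ (v p.2 - v p.1) * gn v p.2 * gn v p.2 ∂(μ.prod μ) =
      ∫ x, (- ∫ y, Θ (v y - v x) * laplacian v y ∂μ) ∂μ := by
    rw [integral_prod _ j2]
    congr 1; ext x
    rw [hμ, setIntegral_eq_integral_of_forall_compl_eq_zero,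
      setIntegral_eq_integral_of_forall_compl_eq_zero, ← green_ident hv hsupp hΘ hκ]
    · simp only [sq, mul_assoc]
    · intro y hy; simp [LO y hy]
    · intro y hy; simp [gnO y hy]
  set Φ : E2 → ℝ := fun y => ∫ x, Θ (v y - v x) ∂μ with hΦ
  have ck : Continuous (Function.uncurry fun y x : E2 => Θ (v y - v x)) := by fun_prop
  obtain ⟨mΦ, bΦ, tri⟩ := triple_ineq μ (fun y x => Θ (v y - v x)) ck.measurable
    (fun _ _ => hΘb _) (fun a b c => tri_kernel Θ hΘm hΘo hΘb _ _ _)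
  have hMM : μ.real Set.univ = volume.real Ω := by
    rw [hμ, measureReal_restrict_apply_univ]
  have cu : Continuous fun p : E2 × E2 => Θ (v p.2 - v p.1) * laplacian v p.2 := by fun_prop
  have r4 : ∫ x, (- ∫ y, Θ (v y - v x) * laplacian v y ∂μ) ∂μ = - ∫ y, laplacian v y * Φ y ∂μ := by
    rw [integral_neg, integral_integral_swap]
    · congr 2; ext y
      rw [integral_mul_const, mul_comm]
    · refine bdd_integrable _ cu.measurable (1/2 * D') fun p => ?_
      rw [Function.uncurry, abs_mul]
      exact mul_le_mul (hΘb _) (hD' _) (abs_nonneg _) (by norm_num)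
  have iL2 : Integrable (fun y => laplacian v y ^ 2) μ := by
    refine bdd_integrable _ (cL.measurable.pow_const 2) (D'^2) fun a => ?_
    rw [abs_pow]; exact pow_le_pow_left₀ (abs_nonneg _) (hD' a) 2
  have iΦ2 : Integrable (fun y => Φ y ^ 2) μ := by
    refine bdd_integrable _ (mΦ.pow_const 2) ((1/2 * μ.real Set.univ)^2) fun a => ?_
    rw [abs_pow]; exact pow_le_pow_left₀ (abs_nonneg _) (bΦ a) 2
  have iLΦ : Integrable (fun y => laplacian v y * Φ y) μ := by
    refine bdd_integrable _ (cL.measurable.mul mΦ) (D' * (1/2 * μ.real Set.univ)) fun a => ?_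
    rw [abs_mul]
    exact mul_le_mul (hD' _) (bΦ _) (abs_nonneg _) ((norm_nonneg _).trans (hD' 0))
  have hπ := Real.pi_pos
  have r5 : - ∫ y, laplacian v y * Φ y ∂μ ≤
      2 * π * (∫ y, laplacian v y ^ 2 ∂μ) + 1 / (8 * π) * ∫ y, Φ y ^ 2 ∂μ := by
    rw [← integral_neg, ← integral_const_mul, ← integral_const_mul,
      ← integral_add (iL2.const_mul _) (iΦ2.const_mul _)]
    refine integral_mono iLΦ.neg ((iL2.const_mul _).add (iΦ2.const_mul _)) fun y => ?_
    show -(laplacian v y * Φ y) ≤ 2 * π * laplacian v y ^ 2 + 1 / (8 * π) * Φ y ^ 2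
    have : 2 * π * laplacian v y ^ 2 + 1 / (8 * π) * Φ y ^ 2 + laplacian v y * Φ y =
        1 / (8 * π) * (4 * π * laplacian v y + Φ y)^2 := by field_simp; ring
    have h2 : 0 ≤ 1 / (8 * π) * (4 * π * laplacian v y + Φ y)^2 := by positivity
    linarith
  have r6 : ∫ y, laplacian v y ^ 2 ∂μ = ∫ y, laplacian v y ^ 2 :=
    setIntegral_eq_integral_of_forall_compl_eq_zero fun x hx => by simp [LO x hx]
  have r7 : ∫ x, A (v x) = ∫ x, A (v x) ∂μ :=
    (setIntegral_eq_integral_of_forall_compl_eq_zero fun x hx => by simp [v0 x hx, hA0]).symm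
  have r8 : ∫ x, |v x| = ∫ x, |v x| ∂μ :=
    (setIntegral_eq_integral_of_forall_compl_eq_zero fun x hx => by simp [v0 x hx]).symm
  have iv : Integrable (fun x => |v x|) μ :=
    (cv.integrable_of_hasCompactSupport hsupp).abs.restrict
  have iA : Integrable (fun x => A (v x)) μ :=
    ((cA.comp cv).integrable_of_hasCompactSupport (HasCompactSupport.intro hsupp
      fun x hx => by simp [image_eq_zero_of_notMem_tsupport hx, hA0])).restrict
  have r9 : (∫ x, |v x|) - ε * volume.real Ω ≤ 2 * ∫ x, A (v x) := by
    rw [r7, r8, ← integral_const_mul]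
    have := integral_mono (iv.sub (integrable_const ε)) (iA.const_mul 2) (fun x => hAl (v x))
    rw [integral_sub' iv (integrable_const ε), integral_const, hMM, smul_eq_mul] at this
    linarith
  rw [hMM] at tri
  have r10 : 1 / (8 * π) * ∫ y, Φ y ^ 2 ∂μ ≤ (volume.real Ω)^3 / (96 * π) := by
    calc _ ≤ 1 / (8 * π) * ((volume.real Ω)^3 / 12) := by gcongr
      _ = _ := by field_simp; ring
  have r11 := mul_le_mul_of_nonneg_left r9 (by positivity : 0 ≤ 4 * π)
  rw [r1] at key
  rw [r3, r4] at r2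
  rw [r6] at r5
  linarith

/-- Variable-load compliance bound in two dimensions: if `Ω ⊆ ℝ²` is open with
area `πR²` and `ρ` is a measurable load with `|ρ| ≤ 1`, then for every smooth
`v` compactly supported in `Ω`, `(1/2)∫(Δv)² − ∫ρv ≥ −πR⁶/384`. -/
theorem stmt_11 (R : ℝ) (hR : 0 < R)
    (Ω : Set (EuclideanSpace ℝ (Fin 2))) (hΩ : IsOpen Ω)
    (hvol : volume Ω = ENNReal.ofReal (π * R^2))
    (ρ : EuclideanSpace ℝ (Fin 2) → ℝ) (hρmeas : Measurable ρ) (hρ : ∀ x, |ρ x| ≤ 1)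
    (v : EuclideanSpace ℝ (Fin 2) → ℝ)
    (hv : ContDiff ℝ (⊤ : ℕ∞) v) (hsupp : HasCompactSupport v) (hsub : tsupport v ⊆ Ω) :
    (1/2) * (∫ x, (laplacian v x)^2) - ∫ x, ρ x * v x ≥ -(π * R^6 / 384) := by
  have hπ := Real.pi_pos
  have hM : volume.real Ω = π * R^2 := by
    rw [Measure.real, hvol, ENNReal.toReal_ofReal (by positivity)]
  have hfin : volume Ω ≠ ⊤ := by rw [hvol]; exact ENNReal.ofReal_ne_top
  have iv : Integrable (fun x => |v x|) :=
    (hv.continuous.integrable_of_hasCompactSupport hsupp).abs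
  have h1 : ∫ x, ρ x * v x ≤ ∫ x, |v x| := by
    refine (le_abs_self _).trans ?_
    rw [← Real.norm_eq_abs]
    refine norm_integral_le_of_norm_le iv (Filter.Eventually.of_forall fun x => ?_)
    rw [Real.norm_eq_abs, abs_mul]
    exact mul_le_of_le_one_left (abs_nonneg _) (hρ x)
  have h2 : ∫ x, |v x| ≤ (1/2) * (∫ x, (laplacian v x)^2) + π * R^6 / 384 := by
    refine le_of_forall_pos_le_add fun δ hδ => ?_
    have h3 := eps_bound (δ / (π * R^2)) (by positivity) Ω hΩ hfin v hv hsupp hsub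
    rw [hM, div_mul_cancel₀ _ (by positivity)] at h3
    have h4 : (π * R^2)^3 / (96 * π) = 4 * π * (π * R^6 / 384) := by field_simp; norm_num
    rw [h4] at h3
    have h5 : 4 * π * ((∫ x, |v x|) - δ) ≤
        4 * π * ((1/2) * (∫ x, (laplacian v x)^2) + π * R^6 / 384) := by linarith
    have := le_of_mul_le_mul_left h5 (by positivity)
    linarith
  linarith
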